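/- arXiv:1007.1371 — 2 statements merged into one kernel-verified Lean document; each statement's English description precedes it below -/
import Mathlib

section
/- For every n there exist N ≥ 1 such that for every k ≥ 1 and every state s over the deck {1, …, n}, the number of Boolean choice sequences c of length k·N for which the play from s determined by c never reaches a final state within k·N steps is at most (2^N − 1)^k. (This is the combinatorial content of the statement that, when each of the two card-returning orders is used with positive probability, the probability that the game lasts more than m moves decays geometrically in m, so the expected length of the game is finite.) -/
/-- A game state: the hands of the left and right player. -/
abbrev WarState := List ℕ × List ℕ

/-- A state is final if one of the players has no cards. -/
def Final (s : WarState) : Prop := s.1 = [] ∨ s.2 = []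

/-- A state is over the deck `{1, …, n}`. -/
def OverDeck (n : ℕ) (s : WarState) : Prop := (s.1 ++ s.2).Perm (List.range' 1 n)

/-- The choice-determined step: final states are fixed; otherwise the player with
the higher top card collects both cards, and the Boolean selects in which of the
two possible orders they are placed at the bottom of the winner's hand. -/
def step (c : Bool) : WarState → WarState
  | ([], R) => ([], R)
  | (L, []) => (L, [])
  | (a :: L, b :: R) =>
      if a > b then
        (if c then (L ++ [a, b], R) else (L ++ [b, a], R))
      else if b > a then
        (if c then (L, R ++ [a, b]) else (L, R ++ [b, a]))
      else (a :: L, b :: R)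

/-- The state of the play from `s` determined by the choice sequence `c` after
`j` steps (only the first `j` choices are used). -/
def play {m : ℕ} (s : WarState) (c : Fin m → Bool) (j : ℕ) : WarState :=
  ((List.ofFn c).take j).foldl (fun t b => step b t) s

/-- The number of choice sequences of length `m` after which the play from `s` is not final. -/
noncomputable def survivors : ℕ → WarState → ℕ
  | 0, s => open Classical in if Final s then 0 else 1
  | m + 1, s => survivors m (step true s) + survivors m (step false s)

/-- Some choice sequence leads from `s` to a final state. -/
def CanFinish (s : WarState) : Prop :=
  ∃ l : List Bool, Final (l.foldl (fun t b => step b t) s)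

theorem Final.step_eq {s : WarState} (h : Final s) (b : Bool) : step b s = s := by
  obtain ⟨_ | ⟨a, L⟩, _ | ⟨b', R⟩⟩ := s <;> simp_all [Final, step]

theorem OverDeck.step {n : ℕ} {s : WarState} (h : OverDeck n s) (b : Bool) :
    OverDeck n (step b s) := by
  obtain ⟨_ | ⟨x, L⟩, _ | ⟨y, R⟩⟩ := s <;> try exact h
  refine List.Perm.trans ?_ h
  simp only [_root_.step]
  rw [List.perm_iff_count]
  intro z
  split_ifs <;> simp [List.count_cons] <;> omega

theorem survivors_of_final {s : WarState} (h : Final s) (m : ℕ) : survivors m s = 0 := by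
  induction m with
  | zero => simp [survivors, h]
  | succ m ih => simp [survivors, h.step_eq, ih]

theorem survivors_le (m : ℕ) (s : WarState) : survivors m s ≤ 2 ^ m := by
  induction m generalizing s with
  | zero => simp only [survivors]; split_ifs <;> simp
  | succ m ih =>
    have h₁ := ih (step true s)
    have h₂ := ih (step false s)
    rw [survivors, pow_succ]
    omega

theorem survivors_lt (l : List Bool) (s : WarState) (m : ℕ) (hl : l.length ≤ m)
    (h : Final (l.foldl (fun t b => step b t) s)) : survivors m s < 2 ^ m := by
  induction l generalizing s m with
  | nil => rw [survivors_of_final (s := s) h]; positivity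
  | cons b l ih =>
    obtain _ | m := m
    · simp at hl
    have h₀ := ih (step b s) m (by simpa using hl) h
    have h₁ := survivors_le m (step true s)
    have h₂ := survivors_le m (step false s)
    rw [survivors, pow_succ]
    cases b <;> omega

theorem survivors_add_le {n p M : ℕ} (hM : ∀ s, OverDeck n s → survivors p s ≤ M) (m : ℕ)
    (s : WarState) (hs : OverDeck n s) : survivors (m + p) s ≤ survivors m s * M := by
  induction m generalizing s with
  | zero =>
    by_cases h : Final s
    · simp [survivors_of_final h]
    · simpa [survivors, h] using hM s hs
  | succ m ih =>
    rw [Nat.succ_add, survivors, survivors, add_mul]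
    exact add_le_add (ih _ (hs.step _)) (ih _ (hs.step _))

theorem survivors_mul_le {n p M : ℕ} (hM : ∀ s, OverDeck n s → survivors p s ≤ M) (k : ℕ)
    (s : WarState) (hs : OverDeck n s) : survivors (k * p) s ≤ M ^ k := by
  induction k with
  | zero => simpa using survivors_le 0 s
  | succ k ih =>
    rw [Nat.succ_mul, pow_succ]
    exact (survivors_add_le hM _ s hs).trans (Nat.mul_le_mul_right M ih)

theorem survivors_eq_sum (m : ℕ) (s : WarState) :
    survivors m s = open Classical in ∑ c : Fin m → Bool,
      if Final ((List.ofFn c).foldl (fun t b => step b t) s) then 0 else 1 := by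
  induction m generalizing s with
  | zero => rw [Fintype.sum_unique, List.ofFn_zero]; rfl
  | succ m ih =>
    rw [← (Fin.consEquiv fun _ : Fin (m + 1) => Bool).sum_comp, Fintype.sum_prod_type,
      Fintype.sum_bool]
    rw [survivors, ih, ih]
    congr 1 <;> refine Finset.sum_congr rfl fun y _ => ?_ <;>
      rw [List.ofFn_succ] <;> rfl

theorem card_not_final_le (m : ℕ) (s : WarState) :
    Nat.card {c : Fin m → Bool // ∀ j ≤ m, ¬ Final (play s c j)} ≤ survivors m s := by
  classical
  rw [survivors_eq_sum, Nat.card_eq_fintype_card, Fintype.card_subtype, Finset.card_filter]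
  refine Finset.sum_le_sum fun c _ => ?_
  have h : play s c m = (List.ofFn c).foldl (fun t b => step b t) s := by
    rw [play, List.take_of_length_le (by simp)]
  split_ifs with h₁ h₂ <;> try simp
  exact h₁ m le_rfl (h ▸ h₂)

theorem finite_overDeck (n : ℕ) : {s : WarState | OverDeck n s}.Finite := by
  have hp : {l : List ℕ | l.Perm (List.range' 1 n)}.Finite :=
    (List.finite_toSet (List.range' 1 n).permutations).subset fun l hl =>
      List.mem_permutations.2 hl
  refine ((hp.prod (Set.finite_Iic n)).preimage
    (f := fun s : WarState => (s.1 ++ s.2, s.1.length)) ?_).subset fun s hs => ⟨hs, ?_⟩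
  · rintro ⟨L, R⟩ - ⟨L', R'⟩ - h
    simp only [Prod.mk.injEq] at h
    obtain ⟨rfl, rfl⟩ := List.append_inj h.1 h.2
    rfl
  · have := List.Perm.length_eq hs
    simp only [List.length_append, List.length_range'] at this
    simp only [Set.mem_Iic]
    omega

/-- The step together with the information whether the left player won it. -/
def stepWithWinner (x : WarState × Bool) : WarState × Bool :=
  (step x.2 x.1, decide (x.1.2.headI < x.1.1.headI))

theorem stepWithWinner_injOn (n : ℕ) :
    Set.InjOn stepWithWinner {x | OverDeck n x.1 ∧ ¬ Final x.1} := by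
  have ne {a b : ℕ} {L R : List ℕ} (h : OverDeck n (a :: L, b :: R)) : a ≠ b := by
    have := h.nodup_iff.2 List.nodup_range'
    grind
  rintro ⟨⟨_ | ⟨a, L⟩, _ | ⟨b, R⟩⟩, c⟩ ⟨hd, hf⟩ ⟨⟨_ | ⟨a', L'⟩, _ | ⟨b', R'⟩⟩, c'⟩ ⟨hd', hf'⟩ h
    <;> simp only [Final, reduceCtorEq, true_or, or_true, or_self, not_true, not_false_eq_true]
      at hf hf'
  have hab := ne hd
  have hab' := ne hd'
  have key {l l' : List ℕ} {x y x' y' : ℕ} (h : l ++ [x, y] = l' ++ [x', y']) :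
      l = l' ∧ x = x' ∧ y = y' := by
    simpa using List.append_inj' h rfl
  simp only [stepWithWinner, step, List.headI_cons, Prod.mk.injEq] at h
  obtain ⟨h, hw⟩ := h
  rcases lt_or_gt_of_ne hab with hlt | hlt <;> rcases lt_or_gt_of_ne hab' with hlt' | hlt' <;>
    cases c <;> cases c' <;> simp [hlt, hlt', hlt.not_gt, hlt'.not_gt] at h hw ⊢ <;>
    grind

theorem canFinish_of_overDeck {n : ℕ} (s : WarState) (hs : OverDeck n s) : CanFinish s := by
  set C : Set (WarState × Bool) := {x | OverDeck n x.1 ∧ ¬ CanFinish x.1}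
  have not_final {t : WarState} (h : ¬ CanFinish t) : ¬ Final t := fun hf => h ⟨[], hf⟩
  have fin : C.Finite := ((finite_overDeck n).prod (Set.finite_univ (α := Bool))).subset
    fun x hx => ⟨hx.1, trivial⟩
  have maps : Set.MapsTo stepWithWinner C C := fun x hx =>
    ⟨hx.1.step _, fun ⟨l, hl⟩ => hx.2 ⟨x.2 :: l, hl⟩⟩
  have sub : C ⊆ {x | OverDeck n x.1 ∧ ¬ Final x.1} := fun x hx => ⟨hx.1, not_final hx.2⟩
  have bij := (fin.injOn_iff_bijOn_of_mapsTo maps).1 ((stepWithWinner_injOn n).mono sub)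
  have descent : ∀ (m : ℕ) (t : WarState), t.1.length = m → OverDeck n t → CanFinish t := by
    intro m
    induction m with
    | zero => exact fun t ht _ => ⟨[], Or.inl (List.length_eq_zero_iff.1 ht)⟩
    | succ m ih =>
      intro t ht hd
      by_contra hn
      obtain ⟨⟨u, b⟩, hu, h⟩ := bij.surjOn (show (t, true) ∈ C by exact ⟨hd, hn⟩)
      refine hu.2 (ih u ?_ hu.1)
      have hf := not_final hu.2
      obtain ⟨_ | ⟨x, L⟩, _ | ⟨y, R⟩⟩ := u <;> simp [Final] at hf
      simp only [stepWithWinner, step, List.headI_cons, Prod.mk.injEq] at h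
      obtain ⟨rfl, h⟩ := h
      cases b <;> simpa [of_decide_eq_true h] using ht
  exact descent _ s rfl hs

theorem exists_survivors_le (n : ℕ) :
    ∃ N : ℕ, 1 ≤ N ∧ ∀ s, OverDeck n s → survivors N s ≤ 2 ^ N - 1 := by
  choose! l hl using canFinish_of_overDeck (n := n)
  obtain ⟨B, hB⟩ := ((finite_overDeck n).image fun s => (l s).length).bddAbove
  refine ⟨B + 1, by omega, fun s hs => Nat.le_sub_one_of_lt ?_⟩
  exact survivors_lt (l s) s _ ((hB ⟨s, hs, rfl⟩).trans (Nat.le_succ B)) (hl s hs)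

/-- There is `N ≥ 1` such that for every `k ≥ 1` and every state over the deck
`{1, …, n}`, at most `(2^N − 1)^k` of the `2^(k·N)` choice sequences of length
`k·N` keep the game away from a final state during all `k·N` steps. -/
theorem war_geometric_decay (n : ℕ) :
    ∃ N : ℕ, 1 ≤ N ∧ ∀ k : ℕ, 1 ≤ k → ∀ s : WarState, OverDeck n s →
      Nat.card {c : Fin (k * N) → Bool // ∀ j ≤ k * N, ¬ Final (play s c j)}
        ≤ (2 ^ N - 1) ^ k := by
  obtain ⟨N, hN, h⟩ := exists_survivors_le n
  exact ⟨N, hN, fun k _ s hs => (card_not_final_le _ s).trans (survivors_mul_le h k s hs)⟩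
end

section
/- Every state (L, R) whose combined list L ++ R has no duplicate entries and in which the left player has exactly one card while the right player has at least two cards (|L| = 1 and |R| ≥ 2) has exactly one predecessor, namely one in which the right player won the preceding play; symmetrically, if |R| = 1 and |L| ≥ 2 the state has exactly one predecessor, in which the left player won. -/
/-- The move relation of the one-suit game of War. -/
inductive Move : WarState → WarState → Prop
  | leftOwnLast (a b : ℕ) (L R : List ℕ) (h : a > b) :
      Move (a :: L, b :: R) (L ++ [a, b], R)
  | leftRivalLast (a b : ℕ) (L R : List ℕ) (h : a > b) :
      Move (a :: L, b :: R) (L ++ [b, a], R)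
  | rightOwnLast (a b : ℕ) (L R : List ℕ) (h : b > a) :
      Move (a :: L, b :: R) (L, R ++ [a, b])
  | rightRivalLast (a b : ℕ) (L R : List ℕ) (h : b > a) :
      Move (a :: L, b :: R) (L, R ++ [b, a])

/-- A player holding fewer than two cards lost the preceding play, and the last two cards of the
rival determine it. -/
theorem move_right_append_pair_iff {L R : List ℕ} {x y : ℕ} (hL : L.length < 2) (hxy : x ≠ y)
    (u : WarState) : Move u (L, R ++ [x, y]) ↔ u = (min x y :: L, max x y :: R) := by
  constructor
  · generalize hs : ((L, R ++ [x, y]) : WarState) = s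
    intro h
    cases h with
    | leftOwnLast a b L' R' h | leftRivalLast a b L' R' h =>
      obtain ⟨rfl, -⟩ := Prod.mk.inj hs
      simp at hL
    | rightOwnLast a b L' R' h | rightRivalLast a b L' R' h =>
      obtain ⟨rfl, hR⟩ := Prod.mk.inj hs
      obtain ⟨rfl, hlast⟩ := List.append_inj' hR rfl
      simp only [List.cons.injEq, and_true] at hlast
      obtain ⟨rfl, rfl⟩ := hlast
      simp [h.le]
  · rintro rfl
    rcases lt_or_gt_of_ne hxy with h | h
    · simpa [h.le] using Move.rightOwnLast x y L R h
    · simpa [h.le] using Move.rightRivalLast y x L R h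

/-- The rules of War do not distinguish the two players. -/
theorem Move.swap {u s : WarState} (h : Move u s) : Move u.swap s.swap := by
  cases h with
  | leftOwnLast a b L R h => exact .rightRivalLast b a R L h
  | leftRivalLast a b L R h => exact .rightOwnLast b a R L h
  | rightOwnLast a b L R h => exact .leftRivalLast b a R L h
  | rightRivalLast a b L R h => exact .leftOwnLast b a R L h

theorem List.exists_eq_append_pair {α : Type*} {l : List α} (h : 2 ≤ l.length) :
    ∃ l' x y, l = l' ++ [x, y] := by
  obtain ⟨x, y, hxy⟩ := List.length_eq_two.mp
    (show (l.drop (l.length - 2)).length = 2 by rw [List.length_drop]; omega)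
  exact ⟨l.take (l.length - 2), x, y, by rw [← hxy, List.take_append_drop]⟩

theorem existsUnique_predecessor_right {L R : List ℕ} (hnodup : R.Nodup) (hL : L.length = 1)
    (hR : 2 ≤ R.length) :
    ∃ t : WarState, {u : WarState | Move u (L, R)} = {t} ∧ t.2.length + 1 = R.length := by
  obtain ⟨R, x, y, rfl⟩ := List.exists_eq_append_pair hR
  have hxy : x ≠ y := by simpa using hnodup.of_append_right
  refine ⟨(min x y :: L, max x y :: R), ?_, by simp⟩
  ext u
  exact move_right_append_pair_iff (by omega) hxy u

/-- A player left with a single card cannot have won the preceding play, so a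
state with `|L| = 1` and `|R| ≥ 2` (all cards distinct) has exactly one
predecessor, in which the right player won; symmetrically for `|R| = 1`,
`|L| ≥ 2`, where the left player won. -/
theorem war_one_predecessor (L R : List ℕ) (hnodup : (L ++ R).Nodup) :
    (L.length = 1 → 2 ≤ R.length →
      ∃ t : WarState, {u : WarState | Move u (L, R)} = {t} ∧
        t.2.length + 1 = R.length) ∧   -- the right player won the play leading to `(L, R)`
    (R.length = 1 → 2 ≤ L.length →
      ∃ t : WarState, {u : WarState | Move u (L, R)} = {t} ∧
        t.1.length + 1 = L.length) := by  -- the left player won the play leading to `(L, R)`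
  refine ⟨existsUnique_predecessor_right hnodup.of_append_right, fun hR hL => ?_⟩
  obtain ⟨t, ht, hlen⟩ := existsUnique_predecessor_right hnodup.of_append_left hR hL
  refine ⟨t.swap, ?_, hlen⟩
  ext u
  have key : Move u.swap (R, L) ↔ u.swap = t := Set.ext_iff.mp ht u.swap
  calc Move u (L, R) ↔ Move u.swap (R, L) := ⟨Move.swap, Move.swap⟩
    _ ↔ u.swap = t := key
    _ ↔ u = t.swap := Prod.swap_eq_iff_eq_swap
end
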